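/- Let n ≥ 2 be a natural number and let f : (0,∞) → ℝ be twice continuously differentiable with f'(s)² < 1 for every s > 0. Define u on ℝⁿ ∖ {0} (ℝⁿ with the Euclidean inner product) by u(x) = f(‖x‖). Then the following are equivalent: (i) for every x ≠ 0, the divergence (the sum over an orthonormal basis (eᵢ) of the eᵢ-th directional derivative of the eᵢ-th component) of the vector field x ↦ ∇u(x)/√(1 − ‖∇u(x)‖²) equals 1/√(1 − ‖∇u(x)‖²); (ii) f''(s) = (1 − f'(s)²)·(1 − (n−1)·f'(s)/s) for every s > 0. -/

import Mathlib

open Set Filter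

theorem aux_norm {n : ℕ} (x : EuclideanSpace ℝ (Fin n)) (hx : x ≠ 0) :
    HasFDerivAt (fun z : EuclideanSpace ℝ (Fin n) => ‖z‖) (‖x‖⁻¹ • innerSL ℝ x) x := by
  have h0 : ‖x‖ ≠ 0 := norm_ne_zero_iff.2 hx
  have h := (hasStrictFDerivAt_norm_sq x).hasFDerivAt.sqrt (pow_ne_zero 2 h0)
  have e : (fun z : EuclideanSpace ℝ (Fin n) => √(‖z‖ ^ 2)) = fun z => ‖z‖ := by
    funext z; exact Real.sqrt_sq (norm_nonneg z)
  rw [e] at h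
  refine h.congr_fderiv ?_
  rw [Real.sqrt_sq (norm_nonneg x)]
  ext v
  simp
  field_simp

theorem aux_radial {n : ℕ} (g : ℝ → ℝ) (g' : ℝ) (x : EuclideanSpace ℝ (Fin n)) (hx : x ≠ 0)
    (hg : HasDerivAt g g' ‖x‖) :
    HasFDerivAt (fun z : EuclideanSpace ℝ (Fin n) => g ‖z‖) ((g' * ‖x‖⁻¹) • innerSL ℝ x) x := by
  have := hg.comp_hasFDerivAt x (aux_norm x hx)
  rw [smul_smul] at this
  exact this

theorem aux_grad {n : ℕ} (f : ℝ → ℝ) (x : EuclideanSpace ℝ (Fin n)) (hx : x ≠ 0)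
    (hf : DifferentiableAt ℝ f ‖x‖) :
    gradient (fun z : EuclideanSpace ℝ (Fin n) => f ‖z‖) x = (deriv f ‖x‖ * ‖x‖⁻¹) • x := by
  apply HasGradientAt.gradient
  rw [hasGradientAt_iff_hasFDerivAt]
  refine (aux_radial f _ x hx hf.hasDerivAt).congr_fderiv ?_
  ext v
  simp

theorem aux_div {n : ℕ} (g : ℝ → ℝ) (g' : ℝ) (x : EuclideanSpace ℝ (Fin n)) (hx : x ≠ 0)
    (hg : HasDerivAt g g' ‖x‖) :
    ∑ i : Fin n, (inner ℝ (fderiv ℝ (fun y : EuclideanSpace ℝ (Fin n) => g ‖y‖ • y) x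
      (EuclideanSpace.single i 1)) (EuclideanSpace.single i 1) : ℝ) = n * g ‖x‖ + g' * ‖x‖ := by
  have h0 : ‖x‖ ≠ 0 := norm_ne_zero_iff.2 hx
  have h := (aux_radial g g' x hx hg).smul (hasFDerivAt_id x)
  have h2 : fderiv ℝ (fun y : EuclideanSpace ℝ (Fin n) => g ‖y‖ • y) x = _ := h.fderiv
  rw [h2]
  have : ∀ i : Fin n, (inner ℝ ((g ‖x‖ • ContinuousLinearMap.id ℝ (EuclideanSpace ℝ (Fin n)) +
      ((g' * ‖x‖⁻¹) • innerSL ℝ x).smulRight (id x)) (EuclideanSpace.single i 1))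
      (EuclideanSpace.single i 1) : ℝ) = g ‖x‖ + g' * ‖x‖⁻¹ * (x i) ^ 2 := by
    intro i
    simp [inner_add_left, inner_smul_left, EuclideanSpace.inner_single_right]
    ring
  rw [Finset.sum_congr rfl (fun i _ => this i), Finset.sum_add_distrib, ← Finset.mul_sum,
    ← EuclideanSpace.real_norm_sq_eq]
  simp
  field_simp

theorem aux_deriv (p : ℝ → ℝ) (q s : ℝ) (hs : 0 < s) (hp : HasDerivAt p q s) (h1 : p s ^ 2 < 1) :
    HasDerivAt (fun t => (√(1 - p t ^ 2))⁻¹ * (p t * t⁻¹))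
      ((p s * q / (√(1 - p s ^ 2)) ^ 3) * (p s * s⁻¹) +
        (√(1 - p s ^ 2))⁻¹ * (q * s⁻¹ + p s * (-(s ^ 2)⁻¹))) s := by
  have hW : 0 < √(1 - p s ^ 2) := Real.sqrt_pos.2 (by linarith)
  have ha := (((hp.pow 2).const_sub 1).sqrt (by simpa using (by linarith : (1 - p s ^ 2) ≠ 0))).inv hW.ne'
  refine (ha.mul (hp.mul (hasDerivAt_inv hs.ne'))).congr_deriv ?_
  simp
  field_simp
  simp

/-- For a rotationally invariant spacelike graph `u(x) = f(‖x‖)` in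
Minkowski space `𝕃^{n+1}` (so `‖∇u‖ < 1`), the graphical translating-soliton equation
`div(∇u / √(1 - ‖∇u‖²)) = 1 / √(1 - ‖∇u‖²)` is equivalent to the ODE
`f'' = (1 - f'²)(1 - (n-1) f'/s)` on `(0, ∞)`. -/
theorem rotational_spacelike_soliton_equation (n : ℕ) (hn : 2 ≤ n) (f : ℝ → ℝ)
    (hf : ContDiffOn ℝ 2 f (Set.Ioi 0))
    (hf' : ∀ s : ℝ, 0 < s → (deriv f s) ^ 2 < 1) :
    (∀ x : EuclideanSpace ℝ (Fin n), x ≠ 0 →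
      (∑ i : Fin n,
        (inner ℝ
          (fderiv ℝ (fun y : EuclideanSpace ℝ (Fin n) =>
            (Real.sqrt (1 - ‖gradient (fun z : EuclideanSpace ℝ (Fin n) => f ‖z‖) y‖ ^ 2))⁻¹ •
              gradient (fun z : EuclideanSpace ℝ (Fin n) => f ‖z‖) y) x
            (EuclideanSpace.single i 1))
          (EuclideanSpace.single i 1) : ℝ))
        = (Real.sqrt (1 - ‖gradient (fun z : EuclideanSpace ℝ (Fin n) => f ‖z‖) x‖ ^ 2))⁻¹)
    ↔
    (∀ s : ℝ, 0 < s →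
      deriv (deriv f) s = (1 - (deriv f s) ^ 2) * (1 - (n - 1 : ℝ) * deriv f s / s)) := by
  have hd : ∀ s : ℝ, 0 < s → DifferentiableAt ℝ f s := fun s hs =>
    (hf.contDiffAt (Ioi_mem_nhds hs)).differentiableAt (by norm_num)
  have hdd : ∀ s : ℝ, 0 < s → DifferentiableAt ℝ (deriv f) s := fun s hs =>
    (((contDiffOn_succ_iff_deriv_of_isOpen (n := 1) isOpen_Ioi).1
      (by simpa [one_add_one_eq_two] using hf)).2.2.contDiffAt
      (Ioi_mem_nhds hs)).differentiableAt (by norm_num)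
  have hnorm : ∀ x : EuclideanSpace ℝ (Fin n), x ≠ 0 →
      ‖gradient (fun z : EuclideanSpace ℝ (Fin n) => f ‖z‖) x‖ ^ 2 = deriv f ‖x‖ ^ 2 := by
    intro x hx
    have h0 : ‖x‖ ≠ 0 := norm_ne_zero_iff.2 hx
    rw [aux_grad f x hx (hd _ (norm_pos_iff.2 hx)), norm_smul, mul_pow, Real.norm_eq_abs, sq_abs]
    field_simp
  have key : ∀ x : EuclideanSpace ℝ (Fin n), x ≠ 0 →
      ((∑ i : Fin n,
        (inner ℝ
          (fderiv ℝ (fun y : EuclideanSpace ℝ (Fin n) =>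
            (Real.sqrt (1 - ‖gradient (fun z : EuclideanSpace ℝ (Fin n) => f ‖z‖) y‖ ^ 2))⁻¹ •
              gradient (fun z : EuclideanSpace ℝ (Fin n) => f ‖z‖) y) x
            (EuclideanSpace.single i 1))
          (EuclideanSpace.single i 1) : ℝ))
        = (Real.sqrt (1 - ‖gradient (fun z : EuclideanSpace ℝ (Fin n) => f ‖z‖) x‖ ^ 2))⁻¹ ↔
      deriv (deriv f) ‖x‖ =
        (1 - (deriv f ‖x‖) ^ 2) * (1 - (n - 1 : ℝ) * deriv f ‖x‖ / ‖x‖)) := by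
    intro x hx
    have hs : 0 < ‖x‖ := norm_pos_iff.2 hx
    have hev : (fun y : EuclideanSpace ℝ (Fin n) =>
            (Real.sqrt (1 - ‖gradient (fun z : EuclideanSpace ℝ (Fin n) => f ‖z‖) y‖ ^ 2))⁻¹ •
              gradient (fun z : EuclideanSpace ℝ (Fin n) => f ‖z‖) y) =ᶠ[nhds x]
        (fun y => (fun t => (√(1 - deriv f t ^ 2))⁻¹ * (deriv f t * t⁻¹)) ‖y‖ • y) := by
      filter_upwards [isOpen_ne.mem_nhds hx] with y hy
      rw [hnorm y hy, aux_grad f y hy (hd _ (norm_pos_iff.2 hy)), smul_smul]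
    rw [hev.fderiv_eq, aux_div _ _ x hx
      (aux_deriv (deriv f) _ ‖x‖ hs (hdd _ hs).hasDerivAt (hf' _ hs)), hnorm x hx]
    have h1 := hf' _ hs
    generalize ‖x‖ = s at *
    generalize deriv (deriv f) s = q
    generalize deriv f s = p at *
    have hW : 0 < √(1 - p ^ 2) := Real.sqrt_pos.2 (by linarith)
    have hW2 : √(1 - p ^ 2) ^ 2 = 1 - p ^ 2 := Real.sq_sqrt (by linarith)
    generalize √(1 - p ^ 2) = W at *
    rw [← hW2]
    have hE : n * (W⁻¹ * (p * s⁻¹)) +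
        (p * q / W ^ 3 * (p * s⁻¹) + W⁻¹ * (q * s⁻¹ + p * -(s ^ 2)⁻¹)) * s - W⁻¹
        = (q - W ^ 2 * (1 - (n - 1 : ℝ) * p / s)) / W ^ 3 := by
      field_simp
      linear_combination (q * s) * hW2
    rw [← sub_eq_zero, hE, div_eq_zero_iff, or_iff_left (pow_ne_zero 3 hW.ne'), sub_eq_zero]
  constructor
  · intro H s hs
    have hx : ‖(EuclideanSpace.single (⟨0, by omega⟩ : Fin n) s : EuclideanSpace ℝ (Fin n))‖ = s := by
      simp [abs_of_pos hs]
    have hx0 : (EuclideanSpace.single (⟨0, by omega⟩ : Fin n) s : EuclideanSpace ℝ (Fin n)) ≠ 0 := by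
      rw [← norm_pos_iff, hx]; exact hs
    have := (key _ hx0).1 (H _ hx0)
    rwa [hx] at this
  · intro H x hx
    exact (key x hx).2 (H _ (norm_pos_iff.2 hx))
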